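/- Let N ≥ 2, let a ≥ 0 be a constant and let ν > 0. There exists k > 0, depending only on N, ν and a, with the following property: if u : Q_{3/2} → ℝ is a C² function with u ≥ 0 on Q_{3/2} and −Δu(x) + a·u(x) ≥ 0 for all x ∈ Q_{3/2}, and if the Lebesgue measure of {x ∈ Q₁ : u(x) > x_N} is at least ν, then u(x) > k·x_N for every x ∈ Q₁. -/

import Mathlib

open MeasureTheory Metric Set

/-- The Laplacian of a real-valued function on `ℝ^N`, as the sum of second
partial derivatives in the coordinate directions. -/
noncomputable def lap {N : ℕ} (u : EuclideanSpace ℝ (Fin N) → ℝ)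
    (x : EuclideanSpace ℝ (Fin N)) : ℝ :=
  ∑ i : Fin N, fderiv ℝ (fun y => fderiv ℝ u y (EuclideanSpace.single i 1)) x
    (EuclideanSpace.single i 1)

/-- The open cube `Q_ρ(y)` of center `y` and side length `ρ`. -/
def cube {N : ℕ} (ρ : ℝ) (y : EuclideanSpace ℝ (Fin N)) :
    Set (EuclideanSpace ℝ (Fin N)) :=
  {x | ∀ i : Fin N, |x i - y i| < ρ / 2}

open Filter Topology

theorem hasDerivAt_max_zero_pow_three (t : ℝ) :
    HasDerivAt (fun t : ℝ => (max 0 t) ^ 3) (3 * (max 0 t) ^ 2) t := by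
  rcases lt_trichotomy t 0 with h | h | h
  · have : (fun t : ℝ => (max 0 t) ^ 3) =ᶠ[𝓝 t] fun _ => 0 := by
      filter_upwards [Iio_mem_nhds h] with s hs
      rw [max_eq_left (le_of_lt hs)]; norm_num
    rw [max_eq_left h.le]
    simpa using (hasDerivAt_const t (0 : ℝ)).congr_of_eventuallyEq this
  · subst h
    have : (fun t : ℝ => (max 0 t) ^ 3) =O[𝓝 0] fun x : ℝ => ‖x - 0‖ ^ 3 := by
      refine Asymptotics.isBigO_of_le _ fun x => ?_
      simp only [sub_zero, norm_pow, Real.norm_eq_abs, abs_abs]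
      exact pow_le_pow_left₀ (abs_nonneg _)
        (by rw [abs_of_nonneg (le_max_left _ _)]; exact max_le (abs_nonneg _) (le_abs_self _)) 3
    simpa using (this.hasFDerivAt (𝕜 := ℝ) (by norm_num)).hasDerivAt
  · have : (fun t : ℝ => (max 0 t) ^ 3) =ᶠ[𝓝 t] fun t => t ^ 3 := by
      filter_upwards [Ioi_mem_nhds h] with s hs
      rw [max_eq_right (le_of_lt hs)]
    rw [max_eq_right h.le]
    simpa using (hasDerivAt_pow 3 t).congr_of_eventuallyEq this

/-- The compactly supported radial weight `(1 - |z|²)₊²`. -/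
noncomputable def radialWeight {N : ℕ} (z : EuclideanSpace ℝ (Fin N)) : ℝ :=
  (max 0 (1 - ‖z‖ ^ 2)) ^ 2

/-- The radial potential of `radialWeight`: its gradient at `z` is `-radialWeight z • z`. -/
noncomputable def radialPotential {N : ℕ} (z : EuclideanSpace ℝ (Fin N)) : ℝ :=
  (max 0 (1 - ‖z‖ ^ 2)) ^ 3 / 6

section radial

variable {N : ℕ}

theorem radialWeight_nonneg (z : EuclideanSpace ℝ (Fin N)) : 0 ≤ radialWeight z := sq_nonneg _

theorem radialPotential_nonneg (z : EuclideanSpace ℝ (Fin N)) : 0 ≤ radialPotential z := by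
  have : 0 ≤ max 0 (1 - ‖z‖ ^ 2) := le_max_left _ _
  unfold radialPotential; positivity

theorem radialPotential_le_radialWeight (z : EuclideanSpace ℝ (Fin N)) :
    radialPotential z ≤ radialWeight z := by
  have h0 : 0 ≤ max 0 (1 - ‖z‖ ^ 2) := le_max_left _ _
  have h1 : max 0 (1 - ‖z‖ ^ 2) ≤ 1 := max_le zero_le_one (by nlinarith [sq_nonneg ‖z‖])
  unfold radialPotential radialWeight
  nlinarith [mul_nonneg (sq_nonneg (max 0 (1 - ‖z‖ ^ 2))) (sub_nonneg.2 h1)]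

theorem radialPotential_eq_zero {z : EuclideanSpace ℝ (Fin N)} (hz : 1 ≤ ‖z‖) :
    radialPotential z = 0 := by
  have : max 0 (1 - ‖z‖ ^ 2) = 0 := max_eq_left (by nlinarith)
  simp [radialPotential, this]

theorem radialWeight_eq_zero {z : EuclideanSpace ℝ (Fin N)} (hz : 1 ≤ ‖z‖) :
    radialWeight z = 0 := by
  have : max 0 (1 - ‖z‖ ^ 2) = 0 := max_eq_left (by nlinarith)
  simp [radialWeight, this]

theorem continuous_radialWeight : Continuous (radialWeight (N := N)) := by
  unfold radialWeight; fun_prop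

theorem continuous_radialPotential : Continuous (radialPotential (N := N)) := by
  unfold radialPotential; fun_prop

theorem hasCompactSupport_radialWeight : HasCompactSupport (radialWeight (N := N)) :=
  HasCompactSupport.intro (isCompact_closedBall 0 1) fun z hz =>
    radialWeight_eq_zero (by simpa using (not_le.1 (by simpa using hz)).le)

theorem hasCompactSupport_radialPotential : HasCompactSupport (radialPotential (N := N)) :=
  HasCompactSupport.intro (isCompact_closedBall 0 1) fun z hz =>
    radialPotential_eq_zero (by simpa using (not_le.1 (by simpa using hz)).le)

theorem hasFDerivAt_radialPotential (z : EuclideanSpace ℝ (Fin N)) :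
    HasFDerivAt radialPotential (-(radialWeight z) • innerSL ℝ z) z := by
  have h1 : HasFDerivAt (fun z : EuclideanSpace ℝ (Fin N) => 1 - ‖z‖ ^ 2)
      (-(2 • innerSL ℝ z)) z := (hasStrictFDerivAt_norm_sq z).hasFDerivAt.const_sub 1
  have h2 := ((hasDerivAt_max_zero_pow_three (1 - ‖z‖ ^ 2)).div_const 6).comp_hasFDerivAt z h1
  refine h2.congr_fderiv ?_
  ext w
  simp [radialWeight]
  ring

theorem fderiv_radialPotential_single (z : EuclideanSpace ℝ (Fin N)) (i : Fin N) :
    fderiv ℝ radialPotential z (EuclideanSpace.single i 1) = -(z i * radialWeight z) := by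
  rw [(hasFDerivAt_radialPotential z).fderiv]
  simp [EuclideanSpace.inner_single_right, mul_comm]

theorem integral_radialWeight_pos : 0 < ∫ z : EuclideanSpace ℝ (Fin N), radialWeight z :=
  continuous_radialWeight.integral_pos_of_hasCompactSupport_nonneg_nonzero
    hasCompactSupport_radialWeight radialWeight_nonneg (x := 0) (by simp [radialWeight])

end radial

section mean

variable {N : ℕ} {v : EuclideanSpace ℝ (Fin N) → ℝ}

theorem contDiff_fderiv_apply (hv : ContDiff ℝ 2 v) (w : EuclideanSpace ℝ (Fin N)) :
    ContDiff ℝ 1 fun x => fderiv ℝ v x w :=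
  (hv.fderiv_right (by norm_num)).clm_apply contDiff_const

/-- Integration by parts: the radial derivative of `v` against the weight is the Laplacian against
the potential. -/
theorem integral_fderiv_mul_radialWeight (hv : ContDiff ℝ 2 v) (y : EuclideanSpace ℝ (Fin N))
    (s : ℝ) :
    ∫ z, fderiv ℝ v (y + s • z) z * radialWeight z =
      s * ∫ z, lap v (y + s • z) * radialPotential z := by
  have hc : ∀ i : Fin N, ContDiff ℝ 1 fun z : EuclideanSpace ℝ (Fin N) =>
      fderiv ℝ v (y + s • z) (EuclideanSpace.single i 1) := fun i =>
    (contDiff_fderiv_apply hv _).comp (contDiff_const.add (contDiff_const_smul s))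
  have hd : ∀ (i : Fin N) (z : EuclideanSpace ℝ (Fin N)),
      fderiv ℝ (fun z => fderiv ℝ v (y + s • z) (EuclideanSpace.single i 1)) z
        (EuclideanSpace.single i 1) =
      s * fderiv ℝ (fun x => fderiv ℝ v x (EuclideanSpace.single i 1)) (y + s • z)
        (EuclideanSpace.single i 1) := by
    intro i z
    have h1 : HasFDerivAt (fun z : EuclideanSpace ℝ (Fin N) => y + s • z)
        (s • ContinuousLinearMap.id ℝ _) z :=
      ((hasFDerivAt_id z).const_smul s).const_add y
    have h2 := (((contDiff_fderiv_apply hv (EuclideanSpace.single i 1)).differentiable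
      (by norm_num)) (y + s • z)).hasFDerivAt
    have h3 := (h2.comp z h1).fderiv
    simp only [Function.comp_def] at h3
    simp [h3]
  have hcd : ∀ i : Fin N, Continuous fun z : EuclideanSpace ℝ (Fin N) =>
      fderiv ℝ (fun x => fderiv ℝ v x (EuclideanSpace.single i 1)) (y + s • z)
        (EuclideanSpace.single i 1) := fun i =>
    (((contDiff_fderiv_apply hv _).continuous_fderiv (by norm_num)).clm_apply
      continuous_const).comp (by fun_prop)
  have hintL : ∀ i : Fin N, Integrable fun z : EuclideanSpace ℝ (Fin N) =>
      fderiv ℝ v (y + s • z) (EuclideanSpace.single i 1) * (z i * radialWeight z) := fun i =>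
    ((hc i).continuous.mul ((by fun_prop : Continuous fun z : EuclideanSpace ℝ (Fin N) => z i).mul
      continuous_radialWeight)).integrable_of_hasCompactSupport
      (hasCompactSupport_radialWeight.mul_left.mul_left)
  have hintR : ∀ i : Fin N, Integrable fun z : EuclideanSpace ℝ (Fin N) =>
      fderiv ℝ (fun x => fderiv ℝ v x (EuclideanSpace.single i 1)) (y + s • z)
        (EuclideanSpace.single i 1) * radialPotential z := fun i =>
    ((hcd i).mul continuous_radialPotential).integrable_of_hasCompactSupport
      hasCompactSupport_radialPotential.mul_left
  have key : ∀ i : Fin N,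
      ∫ z, fderiv ℝ v (y + s • z) (EuclideanSpace.single i 1) * (z i * radialWeight z) =
      s * ∫ z, fderiv ℝ (fun x => fderiv ℝ v x (EuclideanSpace.single i 1)) (y + s • z)
        (EuclideanSpace.single i 1) * radialPotential z := by
    intro i
    have := integral_mul_fderiv_eq_neg_fderiv_mul_of_integrable (μ := volume)
      (f := radialPotential (N := N))
      (g := fun z => fderiv ℝ v (y + s • z) (EuclideanSpace.single i 1))
      (v := EuclideanSpace.single i 1)
      (by
        refine (hintL i).neg.congr (ae_of_all _ fun z => ?_)
        simp only [fderiv_radialPotential_single, Pi.neg_apply]; ring)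
      (by
        refine ((hintR i).const_mul s).congr (ae_of_all _ fun z => ?_)
        simp only [hd]; ring)
      ((continuous_radialPotential.mul (hc i).continuous).integrable_of_hasCompactSupport
        hasCompactSupport_radialPotential.mul_right)
      (fun z _ => (hasFDerivAt_radialPotential z).differentiableAt)
      (fun z _ => (hc i).differentiable (by norm_num) z)
    simp only [hd, fderiv_radialPotential_single] at this
    refine Eq.trans ?_ (this.symm.trans ?_)
    · rw [← integral_neg]
      exact integral_congr_ae (ae_of_all _ fun z => by ring)
    · rw [← integral_const_mul]
      exact integral_congr_ae (ae_of_all _ fun z => by ring)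
  calc ∫ z, fderiv ℝ v (y + s • z) z * radialWeight z
      = ∫ z, ∑ i, fderiv ℝ v (y + s • z) (EuclideanSpace.single i 1) * (z i * radialWeight z) := by
        refine integral_congr_ae (ae_of_all _ fun z => ?_)
        have hz : z = ∑ i, z i • EuclideanSpace.single i (1 : ℝ) := by
          ext j; simp [Finset.sum_apply, Pi.single_apply]
        have : fderiv ℝ v (y + s • z) z =
            ∑ i, z i * fderiv ℝ v (y + s • z) (EuclideanSpace.single i 1) := by
          conv_lhs => rw [show fderiv ℝ v (y + s • z) z = fderiv ℝ v (y + s • z)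
            (∑ i, z i • EuclideanSpace.single i (1 : ℝ)) from congrArg _ hz]
          simp [map_sum]
        simp only [this, Finset.sum_mul]
        exact Finset.sum_congr rfl fun i _ => by ring
    _ = s * ∑ i, ∫ z, fderiv ℝ (fun x => fderiv ℝ v x (EuclideanSpace.single i 1)) (y + s • z)
        (EuclideanSpace.single i 1) * radialPotential z := by
        rw [integral_finsetSum _ fun i _ => hintL i, Finset.mul_sum]
        exact Finset.sum_congr rfl fun i _ => key i
    _ = _ := by
        rw [← integral_finsetSum _ fun i _ => hintR i]
        simp only [lap, Finset.sum_mul]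

theorem continuous_lap (hv : ContDiff ℝ 2 v) : Continuous (lap v) := by
  unfold lap
  exact continuous_finsetSum _ fun i _ =>
    ((contDiff_fderiv_apply hv _).continuous_fderiv (by norm_num)).clm_apply continuous_const

theorem hasDerivAt_integral_radialWeight (hv : ContDiff ℝ 2 v) (hvc : HasCompactSupport v)
    (y : EuclideanSpace ℝ (Fin N)) (s : ℝ) :
    HasDerivAt (fun s : ℝ => ∫ z, v (y + s • z) * radialWeight z)
      (s * ∫ z, lap v (y + s • z) * radialPotential z) s := by
  rw [← integral_fderiv_mul_radialWeight hv]
  have hv' : Continuous (fderiv ℝ v) := hv.continuous_fderiv (by norm_num)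
  obtain ⟨M, hM⟩ := hv'.bounded_above_of_compact_support (hvc.fderiv ℝ)
  have hM0 : 0 ≤ M := (norm_nonneg _).trans (hM 0)
  refine (hasDerivAt_integral_of_dominated_loc_of_deriv_le (s := univ)
    (F' := fun s z => fderiv ℝ v (y + s • z) z * radialWeight z)
    (bound := fun z => M * radialWeight z) univ_mem ?_ ?_ ?_ ?_ ?_ ?_).2
  · exact Eventually.of_forall fun s =>
      ((hv.continuous.comp (by fun_prop)).mul continuous_radialWeight).aestronglyMeasurable
  · exact ((hv.continuous.comp (by fun_prop)).mul
      continuous_radialWeight).integrable_of_hasCompactSupport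
        hasCompactSupport_radialWeight.mul_left
  · exact (((hv'.comp (by fun_prop)).clm_apply continuous_id).mul
      continuous_radialWeight).aestronglyMeasurable
  · refine ae_of_all _ fun z s _ => ?_
    rcases le_or_gt 1 ‖z‖ with hz | hz
    · simp [radialWeight_eq_zero hz]
    · rw [norm_mul, Real.norm_of_nonneg (radialWeight_nonneg z)]
      refine mul_le_mul_of_nonneg_right ?_ (radialWeight_nonneg z)
      calc _ ≤ ‖fderiv ℝ v (y + s • z)‖ * ‖z‖ := ContinuousLinearMap.le_opNorm _ _
        _ ≤ M * 1 := mul_le_mul (hM _) hz.le (norm_nonneg _) hM0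
        _ = M := mul_one M
  · exact (continuous_radialWeight.integrable_of_hasCompactSupport
      hasCompactSupport_radialWeight).const_mul M
  · refine ae_of_all _ fun z s _ => ?_
    have h1 : HasDerivAt (fun s : ℝ => y + s • z) z s := by
      simpa using ((hasDerivAt_id s).smul_const z).const_add y
    exact (((hv.differentiable (by norm_num)) (y + s • z)).hasFDerivAt.comp_hasDerivAt s
      h1).mul_const _

/-- Mean value inequality for nonnegative functions with `Δv ≤ a v` on a ball. -/
theorem integral_radialWeight_le (hv : ContDiff ℝ 2 v) (hvc : HasCompactSupport v)
    (hv0 : ∀ x, 0 ≤ v x) {a : ℝ} (ha : 0 ≤ a) {y : EuclideanSpace ℝ (Fin N)} {S : ℝ} (hS : 0 < S)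
    (hl : ∀ x ∈ closedBall y S, lap v x ≤ a * v x) :
    ∫ z, v (y + S • z) * radialWeight z ≤
      Real.exp (a * S ^ 2 / 2) * (v y * ∫ z : EuclideanSpace ℝ (Fin N), radialWeight z) := by
  set W : ℝ → ℝ := fun s => ∫ z, v (y + s • z) * radialWeight z with hW
  have hWd := hasDerivAt_integral_radialWeight hv hvc y
  have hcv : ∀ s : ℝ, Continuous fun z => v (y + s • z) := fun s => hv.continuous.comp (by fun_prop)
  have hle : ∀ s ∈ Icc 0 S, ∫ z, lap v (y + s • z) * radialPotential z ≤ a * W s := by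
    intro s hs
    rw [hW, ← integral_const_mul]
    refine integral_mono ?_ ?_ fun z => ?_
    · exact (((continuous_lap hv).comp (by fun_prop)).mul
        continuous_radialPotential).integrable_of_hasCompactSupport
        hasCompactSupport_radialPotential.mul_left
    · exact (((hcv s).mul continuous_radialWeight).integrable_of_hasCompactSupport
        hasCompactSupport_radialWeight.mul_left).const_mul a
    · simp only
      rcases le_or_gt 1 ‖z‖ with hz | hz
      · simp [radialPotential_eq_zero hz, radialWeight_eq_zero hz]
      · have hmem : y + s • z ∈ closedBall y S := by
          simp only [mem_closedBall, dist_self_add_left, norm_smul, Real.norm_of_nonneg hs.1]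
          nlinarith [hs.1, hs.2, norm_nonneg z]
        calc _ ≤ a * v (y + s • z) * radialPotential z :=
              mul_le_mul_of_nonneg_right (hl _ hmem) (radialPotential_nonneg z)
          _ ≤ a * v (y + s • z) * radialWeight z :=
              mul_le_mul_of_nonneg_left (radialPotential_le_radialWeight z)
                (mul_nonneg ha (hv0 _))
          _ = _ := by ring
  have hder : ∀ s, HasDerivAt (fun s => W s * Real.exp (-(a * s ^ 2 / 2)))
      ((s * ∫ z, lap v (y + s • z) * radialPotential z) * Real.exp (-(a * s ^ 2 / 2)) +
        W s * (Real.exp (-(a * s ^ 2 / 2)) * (-(a * s)))) s := by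
    intro s
    refine (hWd s).mul (HasDerivAt.exp ?_)
    convert! (((hasDerivAt_pow 2 s).const_mul a).div_const 2).neg using 1
    simp; ring
  have hanti := antitoneOn_of_deriv_nonpos (convex_Icc 0 S)
    (fun s _ => (hder s).continuousAt.continuousWithinAt)
    (fun s _ => (hder s).differentiableAt.differentiableWithinAt)
    (fun s hs => by
      rw [(hder s).deriv]
      have hs' := interior_subset hs
      have := mul_le_mul_of_nonneg_left (hle s hs') hs'.1
      have he := Real.exp_pos (-(a * s ^ 2 / 2))
      nlinarith)
  have := hanti (left_mem_Icc.2 hS.le) (right_mem_Icc.2 hS.le) hS.le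
  have hW0 : W 0 = v y * ∫ z : EuclideanSpace ℝ (Fin N), radialWeight z := by
    simp [hW, integral_const_mul]
  simp only [hW0] at this
  rw [Real.exp_neg, ← div_eq_mul_inv, div_le_iff₀ (Real.exp_pos _)] at this
  rw [mul_comm (Real.exp _)]
  simpa using this

end mean

section supersolution

variable {N : ℕ}

theorem lap_congr {u v : EuclideanSpace ℝ (Fin N) → ℝ} {x : EuclideanSpace ℝ (Fin N)}
    (h : u =ᶠ[𝓝 x] v) : lap u x = lap v x := by
  unfold lap
  refine Finset.sum_congr rfl fun i _ => ?_
  have : (fun y => fderiv ℝ u y (EuclideanSpace.single i 1)) =ᶠ[𝓝 x]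
      fun y => fderiv ℝ v y (EuclideanSpace.single i 1) :=
    (h.fderiv (𝕜 := ℝ)).mono fun y hy => by simp only [hy]
  rw [this.fderiv_eq]

/-- A nonnegative `C²` function on `Q` with `-Δu + a u ≥ 0`. -/
structure IsSupersolution (a : ℝ) (Q : Set (EuclideanSpace ℝ (Fin N)))
    (u : EuclideanSpace ℝ (Fin N) → ℝ) : Prop where
  contDiffOn : ContDiffOn ℝ 2 u Q
  nonneg : ∀ x ∈ Q, 0 ≤ u x
  lap_le : ∀ x ∈ Q, lap u x ≤ a * u x

theorem IsSupersolution.exists_compactSupport {a : ℝ} {Q : Set (EuclideanSpace ℝ (Fin N))}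
    {u : EuclideanSpace ℝ (Fin N) → ℝ} (hu : IsSupersolution a Q u) (hQ : IsOpen Q)
    {y : EuclideanSpace ℝ (Fin N)} {S : ℝ} (hS : 0 < S) (hy : closedBall y (2 * S) ⊆ Q) :
    ∃ v, ContDiff ℝ 2 v ∧ HasCompactSupport v ∧ (∀ x, 0 ≤ v x) ∧
      (∀ x ∈ closedBall y S, lap v x ≤ a * v x) ∧ ∀ x ∈ closedBall y S, v x = u x := by
  let f : ContDiffBump y := ⟨3 / 2 * S, 2 * S, by positivity, by linarith⟩
  have hsupp : tsupport f = closedBall y (2 * S) := f.tsupport_eq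
  have heq : ∀ x ∈ ball y (3 / 2 * S), f x * u x = u x := fun x hx => by
    rw [f.one_of_mem_closedBall (ball_subset_closedBall hx), one_mul]
  have hsub : closedBall y S ⊆ ball y (3 / 2 * S) := closedBall_subset_ball (by linarith)
  refine ⟨fun x => f x * u x, ?_, f.hasCompactSupport.mul_right, fun x => ?_, fun x hx => ?_,
    fun x hx => heq x (hsub hx)⟩
  · rw [contDiff_iff_contDiffAt]
    intro x
    by_cases hx : x ∈ tsupport f
    · exact f.contDiffAt.mul (hu.contDiffOn.contDiffAt (hQ.mem_nhds (hy (hsupp ▸ hx))))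
    · have : (fun x => f x * u x) =ᶠ[𝓝 x] fun _ => 0 := by
        filter_upwards [(isClosed_tsupport f).isOpen_compl.mem_nhds hx] with z hz
        rw [image_eq_zero_of_notMem_tsupport hz, zero_mul]
      exact contDiffAt_const.congr_of_eventuallyEq this
  · by_cases hx : x ∈ tsupport f
    · exact mul_nonneg f.nonneg (hu.nonneg x (hy (hsupp ▸ hx)))
    · simp [image_eq_zero_of_notMem_tsupport hx]
  · beta_reduce
    rw [lap_congr (v := u), heq x (hsub hx)]
    · exact hu.lap_le x (hy (closedBall_subset_closedBall (by linarith) hx))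
    · filter_upwards [isOpen_ball.mem_nhds (hsub hx)] with z hz using heq z hz

/-- If a supersolution is at least `t` on a measurable subset `A` of a ball, then at the center it
is at least a multiple of `t * volume A`. -/
theorem exists_mul_volume_le (N : ℕ) {a : ℝ} (ha : 0 ≤ a) {S : ℝ} (hS : 0 < S) :
    ∃ c : ℝ, 0 < c ∧ ∀ (Q : Set (EuclideanSpace ℝ (Fin N))) (u : EuclideanSpace ℝ (Fin N) → ℝ)
      (y : EuclideanSpace ℝ (Fin N)) (A : Set (EuclideanSpace ℝ (Fin N))) (t : ℝ),
      IsSupersolution a Q u → IsOpen Q → closedBall y (2 * S) ⊆ Q → MeasurableSet A →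
      A ⊆ closedBall y (S / 2) → 0 ≤ t → (∀ x ∈ A, t ≤ u x) →
      c * t * volume.real A ≤ u y := by
  set I := ∫ z : EuclideanSpace ℝ (Fin N), radialWeight z with hI
  have hIpos : 0 < I := integral_radialWeight_pos
  refine ⟨(9 / 16) * (S ^ N)⁻¹ / (Real.exp (a * S ^ 2 / 2) * I), by positivity, ?_⟩
  intro Q u y A t hu hQ hy hA hAy ht htA
  obtain ⟨v, hv, hvc, hv0, hvl, hvu⟩ := hu.exists_compactSupport hQ hS hy
  have h1 := integral_radialWeight_le hv hvc hv0 ha hS hvl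
  rw [hvu y (mem_closedBall_self hS.le)] at h1
  set B := (fun z => S • z) ⁻¹' ((fun z => y + z) ⁻¹' A) with hB
  have hBm : MeasurableSet B := (hA.preimage (by fun_prop)).preimage (by fun_prop)
  have hBvol : volume.real B = (S ^ N)⁻¹ * volume.real A := by
    rw [hB, measureReal_def, Measure.addHaar_preimage_smul _ hS.ne', measure_preimage_add,
      ENNReal.toReal_mul, ENNReal.toReal_ofReal (abs_nonneg _), measureReal_def,
      abs_of_pos (by positivity)]
    simp
  have hBfin : volume B ≠ ⊤ := by
    refine ((isBounded_ball (x := (0 : EuclideanSpace ℝ (Fin N))) (r := 1)).subset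
      fun z hz => ?_).measure_lt_top.ne
    have := hAy hz
    simp only [mem_closedBall, dist_self_add_left, norm_smul, Real.norm_of_nonneg hS.le] at this
    simp only [mem_ball, dist_zero_right]
    nlinarith
  have h2 : t * (9 / 16) * volume.real B ≤ ∫ z, v (y + S • z) * radialWeight z := by
    have hint : Integrable fun z => v (y + S • z) * radialWeight z :=
      ((hv.continuous.comp (by fun_prop)).mul
        continuous_radialWeight).integrable_of_hasCompactSupport
        hasCompactSupport_radialWeight.mul_left
    calc t * (9 / 16) * volume.real B = ∫ z in B, t * (9 / 16) := by
          simp [mul_comm]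
      _ ≤ ∫ z in B, v (y + S • z) * radialWeight z := by
          refine setIntegral_mono_on (integrableOn_const hBfin) hint.integrableOn hBm
            fun z hz => ?_
          have hzA : y + S • z ∈ A := hz
          have hzn := hAy hzA
          have hmem : y + S • z ∈ closedBall y S :=
            closedBall_subset_closedBall (by linarith) hzn
          simp only [mem_closedBall, dist_self_add_left, norm_smul,
            Real.norm_of_nonneg hS.le] at hzn
          have hz2 : ‖z‖ ≤ 1 / 2 := by nlinarith
          have h34 : 3 / 4 ≤ max 0 (1 - ‖z‖ ^ 2) :=
            le_max_of_le_right (by nlinarith [norm_nonneg z])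
          have hw : 9 / 16 ≤ radialWeight z := by unfold radialWeight; nlinarith
          exact mul_le_mul (by rw [hvu _ hmem]; exact htA _ hzA) hw (by norm_num) (hv0 _)
      _ ≤ _ := setIntegral_le_integral hint
          (ae_of_all _ fun z => mul_nonneg (hv0 _) (radialWeight_nonneg z))
  have h3 := h2.trans h1
  rw [hBvol] at h3
  rw [div_mul_eq_mul_div, div_mul_eq_mul_div, div_le_iff₀ (by positivity)]
  linarith

/-- Weak Harnack inequality on a compact convex set. -/
theorem exists_lower_bound_on_compact {a : ℝ} (ha : 0 ≤ a)
    {Q K : Set (EuclideanSpace ℝ (Fin N))} (hQ : IsOpen Q) (hK : IsCompact K) (hKc : Convex ℝ K)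
    (hKQ : K ⊆ Q) {m : ℝ} (hm : 0 < m) :
    ∃ c : ℝ, 0 < c ∧ ∀ (u : EuclideanSpace ℝ (Fin N) → ℝ) (A : Set (EuclideanSpace ℝ (Fin N)))
      (t : ℝ), IsSupersolution a Q u → MeasurableSet A → A ⊆ K → m ≤ volume.real A → 0 ≤ t →
      (∀ x ∈ A, t ≤ u x) → ∀ x ∈ K, c * t ≤ u x := by
  obtain ⟨r, hr, hrQ⟩ := hK.exists_cthickening_subset_open hQ hKQ
  obtain ⟨ρ, hρ, hρr⟩ : ∃ ρ : ℝ, 0 < ρ ∧ 13 * ρ = r := ⟨r / 13, by positivity, by ring⟩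
  have hball : ∀ z ∈ K, ∀ y ∈ closedBall z ρ, closedBall y (2 * (6 * ρ)) ⊆ Q := by
    intro z hz y hy
    refine (closedBall_subset_closedBall' ?_).trans
      ((closedBall_subset_cthickening hz r).trans hrQ)
    have := mem_closedBall.1 hy
    linarith
  obtain ⟨c, hc, hmean⟩ := exists_mul_volume_le N ha (S := 6 * ρ) (by positivity)
  -- passing from a ball to a neighbouring one
  set b := volume.real (ball (0 : EuclideanSpace ℝ (Fin N)) ρ) with hb
  have hbpos : 0 < b := by
    rw [hb, measureReal_def]
    exact ENNReal.toReal_pos (measure_ball_pos _ _ hρ).ne' measure_ball_lt_top.ne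
  have hbz : ∀ z : EuclideanSpace ℝ (Fin N), volume.real (ball z ρ) = b := fun z => by
    rw [hb, measureReal_def, measureReal_def, Measure.addHaar_ball_center]
  have hstep : ∀ (u : EuclideanSpace ℝ (Fin N) → ℝ) (s : ℝ), IsSupersolution a Q u → 0 ≤ s →
      ∀ z ∈ K, ∀ w ∈ K, dist z w ≤ ρ → (∀ y ∈ ball z ρ, s ≤ u y) →
      ∀ y ∈ ball w ρ, c * b * s ≤ u y := by
    intro u s hu hs z hz w hw hzw hsz y hy
    have := hmean Q u y (ball z ρ) s hu hQ (hball w hw y (ball_subset_closedBall hy))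
      measurableSet_ball (fun x hx => ?_) hs hsz
    · rw [hbz] at this; linarith
    · rw [mem_ball] at hx hy
      rw [mem_closedBall]
      have h1 := dist_triangle4 x z w y
      rw [dist_comm w y] at h1
      linarith
  obtain ⟨n, hn⟩ : ∃ n : ℕ, diam K ≤ n * ρ := by
    obtain ⟨n, hn⟩ := exists_nat_ge (diam K / ρ)
    exact ⟨n, by rwa [div_le_iff₀ hρ] at hn⟩
  have hchain : ∀ (u : EuclideanSpace ℝ (Fin N) → ℝ) (s : ℝ), IsSupersolution a Q u → 0 ≤ s →
      ∀ z ∈ K, (∀ y ∈ ball z ρ, s ≤ u y) → ∀ w ∈ K, (c * b) ^ (n + 1) * s ≤ u w := by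
    intro u s hu hs z hz hsz w hw
    have hmem : ∀ j : ℕ, j ≤ n + 1 → AffineMap.lineMap z w ((j : ℝ) / (n + 1)) ∈ K := by
      intro j hj
      refine hKc.lineMap_mem hz hw ⟨by positivity, ?_⟩
      rw [div_le_one (by positivity)]
      exact_mod_cast hj
    have hind : ∀ j : ℕ, j ≤ n + 1 → ∀ y ∈ ball (AffineMap.lineMap z w ((j : ℝ) / (n + 1))) ρ,
        (c * b) ^ j * s ≤ u y := by
      intro j
      induction j with
      | zero => simpa using hsz
      | succ j ih =>
        intro hj y hy
        have := hstep u ((c * b) ^ j * s) hu (by positivity) _ (hmem j (by omega)) _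
          (hmem (j + 1) hj) ?_ (ih (by omega)) y hy
        · calc _ = c * b * ((c * b) ^ j * s) := by ring
            _ ≤ _ := this
        · rw [dist_lineMap_lineMap]
          have hd : dist z w ≤ n * ρ := (dist_le_diam_of_mem hK.isBounded hz hw).trans hn
          have : dist ((j : ℝ) / (n + 1)) (((j + 1 : ℕ) : ℝ) / (n + 1)) = 1 / (n + 1) := by
            rw [Real.dist_eq, ← sub_div, Nat.cast_add_one, abs_div,
              abs_of_pos (by positivity : (0 : ℝ) < n + 1)]
            congr 1
            rw [sub_add_cancel_left, abs_neg, abs_one]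
          rw [this, div_mul_eq_mul_div, div_le_iff₀ (by positivity)]
          nlinarith
    have := hind (n + 1) le_rfl w
    rw [Nat.cast_add_one, div_self (by positivity), AffineMap.lineMap_apply_one] at this
    exact this (mem_ball_self hρ)
  -- finding a ball that contains a definite part of `A`
  obtain ⟨T, hTK, hT⟩ := hK.elim_nhds_subcover (fun z => ball z ρ) fun z _ => ball_mem_nhds z hρ
  have hcard : (0 : ℝ) < T.card + 1 := by positivity
  refine ⟨(c * b) ^ (n + 1) * (c * (m / (T.card + 1))), by positivity, ?_⟩
  intro u A t hu hA hAK hmA ht htA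
  obtain ⟨z, hzT, hz⟩ : ∃ z ∈ T, m / (T.card + 1) ≤ volume.real (A ∩ ball z ρ) := by
    by_contra! hcon
    have h1 : volume.real A ≤ ∑ z ∈ T, volume.real (A ∩ ball z ρ) := by
      refine (measureReal_mono ?_ ?_).trans (measureReal_biUnion_finset_le T _)
      · intro x hx
        obtain ⟨z, hz, hxz⟩ := mem_iUnion₂.1 (hT (hAK hx))
        exact mem_iUnion₂.2 ⟨z, hz, hx, hxz⟩
      · refine (measure_mono (t := K) ?_).trans_lt hK.measure_lt_top |>.ne
        exact iUnion₂_subset fun z _ => inter_subset_left.trans hAK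
    have h2 : ∑ z ∈ T, volume.real (A ∩ ball z ρ) ≤ T.card * (m / (T.card + 1)) := by
      rw [← nsmul_eq_mul]
      exact Finset.sum_le_card_nsmul _ _ _ fun z hz => (hcon z hz).le
    have h3 : T.card * (m / (T.card + 1)) < m := by
      rw [← mul_div_assoc, div_lt_iff₀ hcard]; nlinarith
    linarith
  have hzK := hTK z hzT
  have hfirst : ∀ y ∈ ball z ρ, c * (m / (T.card + 1)) * t ≤ u y := by
    intro y hy
    have := hmean Q u y (A ∩ ball z ρ) t hu hQ (hball z hzK y (ball_subset_closedBall hy))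
      (hA.inter measurableSet_ball) (fun x hx => ?_) ht fun x hx => htA x hx.1
    · refine le_trans ?_ this
      nlinarith [mul_le_mul_of_nonneg_left hz (mul_nonneg hc.le ht)]
    · have hx2 := hx.2
      rw [mem_ball] at hx2 hy
      rw [mem_closedBall]
      have h1 := dist_triangle_right x y z
      linarith
  intro x hx
  have := hchain u _ hu (by positivity) z hzK hfirst x hx
  linarith

end supersolution

section barrier

theorem IsLocalMin.second_deriv_nonneg {g g' : ℝ → ℝ} {g₂ x : ℝ} (hmin : IsLocalMin g x)
    (hg : ∀ᶠ t in 𝓝 x, HasDerivAt g (g' t) t) (hg' : HasDerivAt g' g₂ x) : 0 ≤ g₂ := by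
  have hd : deriv g =ᶠ[𝓝 x] g' := hg.mono fun t ht => ht.deriv
  have hdd : deriv (deriv g) x = g₂ := by rw [hd.deriv_eq, hg'.deriv]
  by_contra! hneg
  have hmax := isLocalMax_of_deriv_deriv_neg (hdd ▸ hneg) hmin.deriv_eq_zero
    hg.self_of_nhds.continuousAt
  have hconst : g =ᶠ[𝓝 x] fun _ => g x := by
    filter_upwards [hmin, hmax] with t h1 h2 using le_antisymm h2 h1
  have h0 : deriv g =ᶠ[𝓝 x] fun _ => 0 := by
    simpa using hconst.deriv
  rw [h0.deriv_eq, deriv_const] at hdd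
  exact hneg.ne hdd.symm

variable {N : ℕ}

theorem hasDerivAt_fderiv_line {u : EuclideanSpace ℝ (Fin N) → ℝ}
    {Q : Set (EuclideanSpace ℝ (Fin N))} (hQ : IsOpen Q) (hu : ContDiffOn ℝ 2 u Q)
    {x : EuclideanSpace ℝ (Fin N)} (hx : x ∈ Q) (w : EuclideanSpace ℝ (Fin N)) :
    (∀ᶠ t in 𝓝 (0 : ℝ), HasDerivAt (fun t : ℝ => u (x + t • w)) (fderiv ℝ u (x + t • w) w) t) ∧
    HasDerivAt (fun t : ℝ => fderiv ℝ u (x + t • w) w)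
      (fderiv ℝ (fun y => fderiv ℝ u y w) x w) 0 := by
  have hline : ∀ t : ℝ, HasDerivAt (fun t : ℝ => x + t • w) w t := fun t => by
    simpa using ((hasDerivAt_id t).smul_const w).const_add x
  have hx0 : x + (0 : ℝ) • w = x := by simp
  constructor
  · have : ∀ᶠ t in 𝓝 (0 : ℝ), x + t • w ∈ Q :=
      (hline 0).continuousAt.eventually_mem (by rw [hx0]; exact hQ.mem_nhds hx)
    filter_upwards [this] with t ht
    exact (((hu.contDiffAt (hQ.mem_nhds ht)).differentiableAt
      (by norm_num)).hasFDerivAt).comp_hasDerivAt t (hline t)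
  · have h1 : DifferentiableAt ℝ (fun y => fderiv ℝ u y w) x :=
      ((((hu.contDiffAt (hQ.mem_nhds hx)).fderiv_right (m := 1) (by norm_num)).clm_apply
        contDiffAt_const).differentiableAt (by norm_num))
    have h2 := h1.hasFDerivAt
    rw [← hx0] at h2
    exact (h2.comp_hasDerivAt 0 (hline 0)).congr_deriv (by rw [hx0])

theorem fderiv_fderiv_sub_gaussian_nonneg {u : EuclideanSpace ℝ (Fin N) → ℝ}
    {Q : Set (EuclideanSpace ℝ (Fin N))} (hQ : IsOpen Q) (hu : ContDiffOn ℝ 2 u Q)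
    {x z : EuclideanSpace ℝ (Fin N)} (hx : x ∈ Q) {α c d : ℝ}
    (hmin : IsLocalMin (fun y => u y - c * (Real.exp (-(α * ‖y - z‖ ^ 2)) - d)) x) (i : Fin N) :
    c * (4 * α ^ 2 * (x - z) i ^ 2 - 2 * α) * Real.exp (-(α * ‖x - z‖ ^ 2)) ≤
      fderiv ℝ (fun y => fderiv ℝ u y (EuclideanSpace.single i 1)) x
        (EuclideanSpace.single i 1) := by
  obtain ⟨h1, h2⟩ := hasDerivAt_fderiv_line hQ hu hx (EuclideanSpace.single i 1)
  set p := (x - z) i with hp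
  set q : ℝ → ℝ := fun t => -(α * (‖x - z‖ ^ 2 + 2 * t * p + t ^ 2)) with hq
  have hnorm : ∀ t : ℝ, ‖x + t • EuclideanSpace.single i (1 : ℝ) - z‖ ^ 2 =
      ‖x - z‖ ^ 2 + 2 * t * p + t ^ 2 := by
    intro t
    rw [add_sub_right_comm, norm_add_sq_real, inner_smul_right, norm_smul]
    simp [hp, EuclideanSpace.inner_single_right]
    ring
  have hqd : ∀ t, HasDerivAt q (-(α * (2 * p + 2 * t))) t := by
    intro t
    have := ((((((hasDerivAt_id t).const_mul 2).mul_const p).const_add (‖x - z‖ ^ 2)).add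
      (hasDerivAt_pow 2 t)).const_mul α).neg
    refine this.congr_deriv ?_
    simp
  have hed : ∀ t, HasDerivAt (fun t => Real.exp (q t))
      (Real.exp (q t) * (-(α * (2 * p + 2 * t)))) t := fun t => (hqd t).exp
  have hld : HasDerivAt (fun t : ℝ => -(α * (2 * p + 2 * t))) (-(α * 2)) 0 := by
    refine ((((hasDerivAt_id (0 : ℝ)).const_mul 2).const_add (2 * p)).const_mul
      α).neg.congr_deriv ?_
    simp
  have hmin' : IsLocalMin (fun t : ℝ => u (x + t • EuclideanSpace.single i (1 : ℝ)) -
      c * (Real.exp (q t) - d)) 0 := by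
    have hc : ContinuousAt (fun t : ℝ => x + t • EuclideanSpace.single i (1 : ℝ)) 0 := by fun_prop
    have ht : Tendsto (fun t : ℝ => x + t • EuclideanSpace.single i (1 : ℝ)) (𝓝 0) (𝓝 x) := by
      simpa [ContinuousAt] using hc
    have := ht.eventually hmin
    filter_upwards [this] with t ht
    simp only [hnorm] at ht
    simpa [hq] using ht
  have := hmin'.second_deriv_nonneg
    (h1.mono fun t ht => ht.sub (((hed t).sub_const d).const_mul c))
    (h2.sub (((hed 0).mul hld).const_mul c))
  have hq0 : q 0 = -(α * ‖x - z‖ ^ 2) := by simp [hq]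
  rw [hq0] at this
  nlinarith

/-- Quantitative Hopf lemma: a supersolution in a ball that is at least `c` on the concentric ball
of half the radius is bounded below by a multiple of `c` times the distance to the sphere. -/
theorem exists_mul_dist_sphere_le (N : ℕ) {a : ℝ} (ha : 0 ≤ a) {R : ℝ} (hR : 0 < R) :
    ∃ κ : ℝ, 0 < κ ∧ ∀ (Q : Set (EuclideanSpace ℝ (Fin N))) (u : EuclideanSpace ℝ (Fin N) → ℝ)
      (z : EuclideanSpace ℝ (Fin N)) (c : ℝ), IsSupersolution a Q u → IsOpen Q →
      closedBall z R ⊆ Q → 0 < c → (∀ x ∈ closedBall z (R / 2), c ≤ u x) →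
      ∀ x ∈ closedBall z R, κ * c * (R - dist x z) ≤ u x := by
  obtain ⟨α, hα, hαR⟩ : ∃ α : ℝ, 0 < α ∧ a < α ^ 2 * R ^ 2 - 2 * α * N := by
    refine ⟨(2 * N + a + 1) / R ^ 2 + 1, by positivity, ?_⟩
    set α := (2 * N + a + 1) / R ^ 2 + 1 with h
    have h1 : α * R ^ 2 = 2 * N + a + 1 + R ^ 2 := by rw [h]; field_simp
    have h2 : 1 ≤ α := by rw [h]; simp only [le_add_iff_nonneg_left]; positivity
    nlinarith [mul_nonneg (sub_nonneg.2 h2) (by positivity : 0 ≤ a + 1 + R ^ 2), sq_nonneg R]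
  have hER := Real.exp_pos (-(α * R ^ 2))
  refine ⟨min (1 / R) (α * R * Real.exp (-(α * R ^ 2))), by positivity, ?_⟩
  intro Q u z c hu hQ hz hc hcu
  have hcomp : ∀ x ∈ closedBall z R \ ball z (R / 2),
      c * (Real.exp (-(α * ‖x - z‖ ^ 2)) - Real.exp (-(α * R ^ 2))) ≤ u x := by
    by_contra! hcon
    obtain ⟨x₁, hx₁, hneg₁⟩ := hcon
    set h : EuclideanSpace ℝ (Fin N) → ℝ := fun y =>
      u y - c * (Real.exp (-(α * ‖y - z‖ ^ 2)) - Real.exp (-(α * R ^ 2))) with hh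
    have hcont : ContinuousOn h (closedBall z R \ ball z (R / 2)) :=
      (hu.contDiffOn.continuousOn.mono (sdiff_subset.trans hz)).sub
        (by fun_prop : Continuous fun y : EuclideanSpace ℝ (Fin N) =>
          c * (Real.exp (-(α * ‖y - z‖ ^ 2)) - Real.exp (-(α * R ^ 2)))).continuousOn
    obtain ⟨x₀, hx₀, hmin⟩ := ((isCompact_closedBall z R).diff isOpen_ball).exists_isMinOn
      ⟨x₁, hx₁⟩ hcont
    have hneg : h x₀ < 0 := (hmin hx₁).trans_lt (sub_neg.2 hneg₁)
    have hneg' : u x₀ < c * (Real.exp (-(α * ‖x₀ - z‖ ^ 2)) - Real.exp (-(α * R ^ 2))) :=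
      sub_neg.1 hneg
    have hx₀Q : x₀ ∈ Q := hz hx₀.1
    have hr1 : R / 2 < dist x₀ z := by
      by_contra! hle
      have h1 := hcu x₀ hle
      have h2 : Real.exp (-(α * ‖x₀ - z‖ ^ 2)) ≤ 1 :=
        Real.exp_le_one_iff.2 (neg_nonpos.2 (by positivity))
      nlinarith
    have hr2 : dist x₀ z < R := by
      refine lt_of_le_of_ne hx₀.1 fun heq => ?_
      rw [← dist_eq_norm, heq, sub_self, mul_zero] at hneg'
      exact absurd (hu.nonneg x₀ hx₀Q) (not_le.2 hneg')
    have hloc : IsLocalMin h x₀ := by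
      refine hmin.isLocalMin ?_
      have : ball z R ∩ (closedBall z (R / 2))ᶜ ∈ 𝓝 x₀ :=
        (isOpen_ball.inter isClosed_closedBall.isOpen_compl).mem_nhds
          ⟨hr2, by simpa using hr1⟩
      refine mem_of_superset this fun y hy => ⟨ball_subset_closedBall hy.1, fun hy' => ?_⟩
      exact hy.2 (ball_subset_closedBall hy')
    have hsum : c * (4 * α ^ 2 * ‖x₀ - z‖ ^ 2 - 2 * α * N) * Real.exp (-(α * ‖x₀ - z‖ ^ 2)) ≤
        lap u x₀ := by
      refine le_trans (le_of_eq ?_) (Finset.sum_le_sum fun i _ =>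
        fderiv_fderiv_sub_gaussian_nonneg hQ hu.contDiffOn hx₀Q hloc i)
      rw [← Finset.sum_mul, ← Finset.mul_sum, Finset.sum_sub_distrib, ← Finset.mul_sum,
        EuclideanSpace.real_norm_sq_eq]
      simp
      ring_nf
      simp
    have hl := hu.lap_le x₀ hx₀Q
    set E := Real.exp (-(α * ‖x₀ - z‖ ^ 2)) with hE
    have hEpos : 0 < E := Real.exp_pos _
    rw [dist_eq_norm] at hr1
    have h4 : α ^ 2 * R ^ 2 ≤ 4 * α ^ 2 * ‖x₀ - z‖ ^ 2 := by
      have : R ^ 2 ≤ 4 * ‖x₀ - z‖ ^ 2 := by nlinarith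
      nlinarith [sq_nonneg α]
    have h5 : a * u x₀ ≤ a * (c * E) :=
      mul_le_mul_of_nonneg_left (by nlinarith) ha
    have h6 : a * (c * E) < (4 * α ^ 2 * ‖x₀ - z‖ ^ 2 - 2 * α * N) * (c * E) :=
      mul_lt_mul_of_pos_right (by linarith) (by positivity)
    nlinarith
  intro x hx
  have hd : dist x z ≤ R := hx
  have hcR : 0 ≤ c * (R - dist x z) := mul_nonneg hc.le (sub_nonneg.2 hd)
  rcases le_or_gt (dist x z) (R / 2) with hle | hgt
  · refine le_trans ?_ (hcu x hle)
    calc _ ≤ 1 / R * c * (R - dist x z) := by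
          rw [mul_assoc, mul_assoc (1 / R)]
          exact mul_le_mul_of_nonneg_right (min_le_left _ _) hcR
      _ ≤ 1 / R * c * R := by gcongr; linarith [dist_nonneg (x := x) (y := z)]
      _ = c := by field_simp
  · refine le_trans ?_ (hcomp x ⟨hx, by simpa using hgt.le⟩)
    rw [← dist_eq_norm]
    have h1 : α * R * (R - dist x z) ≤ α * R ^ 2 - α * dist x z ^ 2 := by
      nlinarith [mul_nonneg (mul_nonneg hα.le (sub_nonneg.2 hd)) (dist_nonneg (x := x) (y := z))]
    have h2 : Real.exp (-(α * dist x z ^ 2)) =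
        Real.exp (-(α * R ^ 2)) * Real.exp (α * R ^ 2 - α * dist x z ^ 2) := by
      rw [← Real.exp_add]; ring_nf
    have h3 := Real.add_one_le_exp (α * R ^ 2 - α * dist x z ^ 2)
    calc _ ≤ α * R * Real.exp (-(α * R ^ 2)) * c * (R - dist x z) := by
          rw [mul_assoc, mul_assoc (α * R * _) c]
          exact mul_le_mul_of_nonneg_right (min_le_right _ _) hcR
      _ = c * (Real.exp (-(α * R ^ 2)) * (α * R * (R - dist x z))) := by ring
      _ ≤ _ := by
          refine mul_le_mul_of_nonneg_left ?_ hc.le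
          rw [h2]
          nlinarith

end barrier

section cube

variable {N : ℕ}

theorem isOpen_cube (ρ : ℝ) (y : EuclideanSpace ℝ (Fin N)) : IsOpen (cube ρ y) := by
  have : cube ρ y = ⋂ i : Fin N, {x | |x i - y i| < ρ / 2} := by ext; simp [cube]
  rw [this]
  exact isOpen_iInter_of_finite fun i => isOpen_lt (by fun_prop) continuous_const

theorem mem_cube_single_iff {ρ : ℝ} {n : Fin N} {x : EuclideanSpace ℝ (Fin N)} :
    x ∈ cube ρ (EuclideanSpace.single n (ρ / 2)) ↔
      (∀ i ≠ n, |x i| < ρ / 2) ∧ 0 < x n ∧ x n < ρ := by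
  constructor
  · intro h
    refine ⟨fun i hi => by simpa [hi] using h i, ?_⟩
    have hn := h n
    simp only [PiLp.single_apply, if_true, abs_lt] at hn
    constructor <;> linarith
  · rintro ⟨h, h0, h1⟩ i
    rcases eq_or_ne i n with rfl | hi
    · simp only [PiLp.single_apply, if_true, abs_lt]
      constructor <;> linarith
    · simpa [hi] using h i hi

theorem volume_cube_inter_lt_le {n : Fin N} {δ : ℝ} :
    volume {x ∈ cube 1 (EuclideanSpace.single n (1 / 2)) | x n < δ} ≤ ENNReal.ofReal δ := by
  have hsub : {x ∈ cube 1 (EuclideanSpace.single n (1 / 2 : ℝ)) | x n < δ} ⊆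
      (WithLp.ofLp : EuclideanSpace ℝ (Fin N) → Fin N → ℝ) ⁻¹'
        Set.pi univ fun i => Ioo (if i = n then 0 else -(1 / 2)) (if i = n then δ else 1 / 2) := by
    rintro x ⟨hx, hxδ⟩ i -
    obtain ⟨h, h0, h1⟩ := mem_cube_single_iff.1 hx
    by_cases hi : i = n
    · subst hi; simpa using ⟨h0, hxδ⟩
    · simpa [hi] using abs_lt.1 (h i hi)
  refine (measure_mono hsub).trans ?_
  rw [(PiLp.volume_preserving_ofLp (Fin N)).measure_preimage
    (MeasurableSet.univ_pi fun i => measurableSet_Ioo).nullMeasurableSet, Real.volume_pi_Ioo,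
    Finset.prod_eq_single n]
  · simp
  · intro i _ hi
    simp [hi]; norm_num
  · simp

/-- The compact box `[-5/8, 5/8]^{N-1} × [δ, 1]`, the last factor being in direction `n`. -/
def innerBox (n : Fin N) (δ : ℝ) : Set (EuclideanSpace ℝ (Fin N)) :=
  {x | (∀ i ≠ n, |x i| ≤ 5 / 8) ∧ δ ≤ x n ∧ x n ≤ 1}

theorem convex_innerBox (n : Fin N) (δ : ℝ) : Convex ℝ (innerBox n δ) := by
  rintro x ⟨hx, hx0, hx1⟩ y ⟨hy, hy0, hy1⟩ s t hs ht hst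
  obtain rfl : t = 1 - s := by linarith
  refine ⟨fun i hi => ?_, ?_, ?_⟩
  · have h1 := abs_le.1 (hx i hi)
    have h2 := abs_le.1 (hy i hi)
    simp only [PiLp.add_apply, PiLp.smul_apply, smul_eq_mul]
    rw [abs_le]
    constructor <;> nlinarith
  · simp only [PiLp.add_apply, PiLp.smul_apply, smul_eq_mul]
    nlinarith
  · simp only [PiLp.add_apply, PiLp.smul_apply, smul_eq_mul]
    nlinarith

theorem isCompact_innerBox (n : Fin N) (δ : ℝ) : IsCompact (innerBox n δ) := by
  refine Metric.isCompact_of_isClosed_isBounded ?_ ?_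
  · have : innerBox n δ = (⋂ i : Fin N, {x | i ≠ n → |x i| ≤ 5 / 8}) ∩
        ({x | δ ≤ x n} ∩ {x | x n ≤ 1}) := by ext; simp [innerBox]
    rw [this]
    refine (isClosed_iInter fun i => ?_).inter
      ((isClosed_le continuous_const (by fun_prop)).inter
        (isClosed_le (by fun_prop) continuous_const))
    by_cases hi : i = n
    · simp [hi]
    · simpa [hi] using isClosed_le (f := fun x : EuclideanSpace ℝ (Fin N) => |x i|)
        (by fun_prop) continuous_const
  · refine isBounded_iff_forall_norm_le.2 ⟨√(∑ _i : Fin N, (1 + |δ|) ^ 2), fun x hx => ?_⟩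
    rw [EuclideanSpace.norm_eq]
    refine Real.sqrt_le_sqrt (Finset.sum_le_sum fun i _ => ?_)
    refine pow_le_pow_left₀ (norm_nonneg _) ?_ 2
    rw [Real.norm_eq_abs]
    by_cases hi : i = n
    · subst hi
      rw [abs_le]
      constructor <;> linarith [hx.2.1, hx.2.2, neg_abs_le δ, abs_nonneg δ]
    · linarith [hx.1 i hi, abs_nonneg δ]

theorem innerBox_subset_cube (n : Fin N) {δ : ℝ} (hδ : 0 < δ) :
    innerBox n δ ⊆ cube (3 / 2) (EuclideanSpace.single n (3 / 2 / 2)) := fun x hx =>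
  mem_cube_single_iff.2 ⟨fun i hi => (hx.1 i hi).trans_lt (by norm_num), hδ.trans_le hx.2.1,
    hx.2.2.trans_lt (by norm_num)⟩

theorem le_measureReal_inter_innerBox {n : Fin N} {u : EuclideanSpace ℝ (Fin N) → ℝ} {δ ν : ℝ}
    (hδ : 0 ≤ δ) (hδν : δ ≤ ν / 2)
    (hν : ENNReal.ofReal ν ≤
      volume {x ∈ cube 1 (EuclideanSpace.single n (1 / 2)) | x n < u x}) :
    ν / 2 ≤ volume.real
      ({x ∈ cube 1 (EuclideanSpace.single n (1 / 2)) | x n < u x} ∩ innerBox n δ) := by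
  set S := {x ∈ cube 1 (EuclideanSpace.single n (1 / 2)) | x n < u x} with hS
  have hsub : S ⊆ (S ∩ innerBox n δ) ∪
      {x ∈ cube 1 (EuclideanSpace.single n (1 / 2)) | x n < δ} := by
    intro x hx
    rcases lt_or_ge (x n) δ with h | h
    · exact Or.inr ⟨hx.1, h⟩
    · obtain ⟨h1, h2, h3⟩ := mem_cube_single_iff.1 hx.1
      exact Or.inl ⟨hx, fun i hi => (h1 i hi).le.trans (by norm_num), h, h3.le⟩
  have hfin : volume (S ∩ innerBox n δ) ≠ ⊤ :=
    ((measure_mono inter_subset_right).trans_lt (isCompact_innerBox n δ).measure_lt_top).ne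
  have h1 := hν.trans ((measure_mono hsub).trans ((measure_union_le _ _).trans
    (add_le_add_right volume_cube_inter_lt_le _)))
  rw [← ENNReal.ofReal_toReal hfin, ← ENNReal.ofReal_add ENNReal.toReal_nonneg hδ,
    ENNReal.ofReal_le_ofReal_iff (by positivity)] at h1
  rw [measureReal_def]
  linarith

theorem abs_sub_apply_le_dist (x y : EuclideanSpace ℝ (Fin N)) (i : Fin N) :
    |x i - y i| ≤ dist x y := by
  rw [dist_eq_norm]
  exact PiLp.norm_apply_le (x - y) i

end cube

/-- Growth lemma (Lemma 3.5 for `p = 2`): here `Q_ρ := Q_ρ(ρe)` with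
`e = (0,…,0,1/2)`, so `Q₁ = (-1/2,1/2)^{N-1} × (0,1)` and
`Q_{3/2} = (-3/4,3/4)^{N-1} × (0,3/2)`. If the set where `u > x_N` in `Q₁` has
measure at least `ν`, then `u > k x_N` in all of `Q₁`. -/
theorem stmt_7 {N : ℕ} (hN : 2 ≤ N) (a : ℝ) (ha : 0 ≤ a) (ν : ℝ) (hν : 0 < ν) :
    ∃ k : ℝ, 0 < k ∧
      ∀ u : EuclideanSpace ℝ (Fin N) → ℝ,
        ContDiffOn ℝ 2 u
          (cube (3 / 2) (EuclideanSpace.single (⟨N - 1, by omega⟩ : Fin N) (3 / 4))) →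
        (∀ x ∈ cube (3 / 2) (EuclideanSpace.single (⟨N - 1, by omega⟩ : Fin N) (3 / 4)),
          0 ≤ u x) →
        (∀ x ∈ cube (3 / 2) (EuclideanSpace.single (⟨N - 1, by omega⟩ : Fin N) (3 / 4)),
          0 ≤ -lap u x + a * u x) →
        ENNReal.ofReal ν ≤
          volume {x ∈ cube 1 (EuclideanSpace.single (⟨N - 1, by omega⟩ : Fin N) (1 / 2)) |
            x ⟨N - 1, by omega⟩ < u x} →
        ∀ x ∈ cube 1 (EuclideanSpace.single (⟨N - 1, by omega⟩ : Fin N) (1 / 2)),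
          k * x ⟨N - 1, by omega⟩ < u x := by
  generalize (⟨N - 1, by omega⟩ : Fin N) = n
  rw [show (3 / 4 : ℝ) = 3 / 2 / 2 by norm_num]
  set Q : Set (EuclideanSpace ℝ (Fin N)) :=
    cube (3 / 2) (EuclideanSpace.single n (3 / 2 / 2)) with hQdef
  have hQ : IsOpen Q := isOpen_cube _ _
  obtain ⟨δ, hδ, hδ16, hδν⟩ : ∃ δ : ℝ, 0 < δ ∧ δ ≤ 1 / 16 ∧ δ ≤ ν / 2 :=
    ⟨min (1 / 16) (ν / 2), by positivity, min_le_left _ _, min_le_right _ _⟩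
  obtain ⟨c, hc, hharnack⟩ := exists_lower_bound_on_compact ha hQ (isCompact_innerBox n δ)
    (convex_innerBox n δ) (innerBox_subset_cube n hδ) (half_pos hν)
  obtain ⟨κ, hκ, hhopf⟩ := exists_mul_dist_sphere_le N ha (R := 1 / 8) (by norm_num)
  have hcδ : 0 < c * δ := by positivity
  refine ⟨min (c * δ) (κ * (c * δ) / 2) / 2, by positivity, ?_⟩
  intro u hu hu0 hul hmeas x hx
  have hsup : IsSupersolution a Q u := ⟨hu, hu0, fun x hx => by linarith [hul x hx]⟩
  set k := min (c * δ) (κ * (c * δ) / 2) with hk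
  have hkpos : 0 < k := by positivity
  obtain ⟨hx1, hx0, hxn⟩ := mem_cube_single_iff.1 hx
  have hQ₁ : cube 1 (EuclideanSpace.single n (1 / 2)) ⊆ Q := fun y hy => by
    obtain ⟨h1, h2, h3⟩ := mem_cube_single_iff.1 hy
    exact mem_cube_single_iff.2 ⟨fun i hi => (h1 i hi).trans (by norm_num), h2, by linarith⟩
  have hopen : IsOpen {x ∈ cube 1 (EuclideanSpace.single n (1 / 2)) | x n < u x} := by
    have hcont : ContinuousOn (fun y => u y - y n) (cube 1 (EuclideanSpace.single n (1 / 2))) :=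
      (hu.continuousOn.mono hQ₁).sub (by fun_prop)
    have := hcont.isOpen_inter_preimage (isOpen_cube _ _) isOpen_Ioi (t := Ioi 0)
    convert this using 1
    ext y
    exact and_congr_right fun _ => sub_pos.symm
  have hinner : ∀ y ∈ innerBox n δ, c * δ ≤ u y :=
    hharnack u _ δ hsup (hopen.measurableSet.inter (isCompact_innerBox n δ).measurableSet)
      inter_subset_right (le_measureReal_inter_innerBox hδ.le hδν hmeas) hδ.le
      fun y hy => hy.2.2.1.trans hy.1.2.le
  suffices h : k * x n ≤ u x by nlinarith [mul_pos hkpos hx0]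
  rcases le_or_gt δ (x n) with hle | hlt
  · refine le_trans ?_ (hinner x ⟨fun i hi => (hx1 i hi).le.trans (by norm_num), hle, hxn.le⟩)
    nlinarith [min_le_left (c * δ) (κ * (c * δ) / 2)]
  · set z : EuclideanSpace ℝ (Fin N) :=
      x + EuclideanSpace.single n (1 / 8 - x n / 2) with hz
    have hzn : z n = 1 / 8 + x n / 2 := by simp [hz]; ring
    have hzi : ∀ i ≠ n, z i = x i := fun i hi => by simp [hz, hi]
    have hdist : dist x z = 1 / 8 - x n / 2 := by
      rw [hz, dist_self_add_right, PiLp.norm_single, Real.norm_of_nonneg (by linarith)]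
    have hzQ : closedBall z (1 / 8) ⊆ Q := by
      intro y hy
      have hd := fun i => abs_le.1 ((abs_sub_apply_le_dist y z i).trans hy)
      refine mem_cube_single_iff.2 ⟨fun i hi => ?_, ?_, ?_⟩
      · have h1 := hd i
        have h2 := abs_lt.1 (hx1 i hi)
        rw [hzi i hi] at h1
        rw [abs_lt]
        constructor <;> linarith
      · have := (hd n).1; linarith
      · have := (hd n).2; linarith
    have hzK : closedBall z (1 / 8 / 2) ⊆ innerBox n δ := by
      intro y hy
      have hd := fun i => abs_le.1 ((abs_sub_apply_le_dist y z i).trans hy)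
      refine ⟨fun i hi => ?_, ?_, ?_⟩
      · have h1 := hd i
        have h2 := abs_lt.1 (hx1 i hi)
        rw [hzi i hi] at h1
        rw [abs_le]
        constructor <;> linarith
      · have := (hd n).1; linarith
      · have := (hd n).2; linarith
    have := hhopf Q u z (c * δ) hsup hQ hzQ hcδ (fun y hy => hinner y (hzK hy)) x
      (by rw [mem_closedBall, hdist]; linarith)
    rw [hdist] at this
    nlinarith [min_le_right (c * δ) (κ * (c * δ) / 2)]
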